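/- For every integer k ≥ 2 and every string w of length n ≥ 1, the sum of the exponents of all runs of w with exponent at least k is strictly less than n(k+1)/(k−1); in particular, the maximum sum of exponents σ_k(n) of runs with exponent at least k in a string of length n satisfies σ_k(n) < n(k+1)/(k−1). -/

import Mathlib

variable {α : Type*}

/-- The substring `w[i..j]` of a 1-indexed string given as a function `w : ℕ → α`. -/
def substr (w : ℕ → α) (i j : ℕ) : List α :=
  (List.range (j + 1 - i)).map (fun k => w (i + k))

/-- `u` is a Lyndon word w.r.t. the strict order `lt`:
`u` is nonempty and lexicographically smaller than each of its nonempty proper suffixes. -/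
def IsLyndon (lt : α → α → Prop) (u : List α) : Prop :=
  u ≠ [] ∧ ∀ v, v ≠ [] → v ≠ u → v <:+ u → List.Lex lt u v

/-- `p` is a period of the substring `w[i..j]`. -/
def IsPeriod (w : ℕ → α) (i j p : ℕ) : Prop :=
  ∀ k, i ≤ k → k + p ≤ j → w k = w (k + p)

/-- `(i,j,p)` is a run of the string `w[1..n]`. -/
def IsRun (w : ℕ → α) (n i j p : ℕ) : Prop :=
  1 ≤ i ∧ j ≤ n ∧ 1 ≤ p ∧ i + 2 * p ≤ j + 1 ∧
  IsPeriod w i j p ∧ (∀ q, 1 ≤ q → q < p → ¬ IsPeriod w i j q) ∧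
  (i = 1 ∨ w (i - 1) ≠ w (i + p - 1)) ∧
  (j = n ∨ w (j + 1) ≠ w (j - p + 1))

/-- The set of runs of the string `w[1..n]`, as triples `(i,j,p)`. -/
def Runs (w : ℕ → α) (n : ℕ) : Set (ℕ × ℕ × ℕ) :=
  { r | IsRun w n r.1 r.2.1 r.2.2 }

/-- The exponent of a run `(i,j,p)`, i.e. `(j-i+1)/p`, as a rational number. -/
def expo (r : ℕ × ℕ × ℕ) : ℚ :=
  ((r.2.1 : ℚ) - (r.1 : ℚ) + 1) / (r.2.2 : ℚ)

/-- `ŵ = w$`: positions `1..n` carry `w`, position `n+1` carries the sentinel `none`. -/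
def hat (w : ℕ → α) (n : ℕ) : ℕ → Option α :=
  fun i => if i ≤ n then some (w i) else none

/-- Extension of a strict order `lt` on `α` to `Option α`, where the sentinel `none`
is smaller than every letter if `small = true`, and larger otherwise. -/
def extLT (small : Bool) (lt : α → α → Prop) : Option α → Option α → Prop
  | none, none => False
  | none, some _ => small = true
  | some _, none => small = false
  | some a, some b => lt a b

/-- The order `≺_ℓ` on `Σ ∪ {$}` (for `ℓ ∈ {0,1}` encoded as `Bool`):
`$ ≺₀ a` and `a ≺₁ $` for every `a ∈ Σ`. -/
def hatOrd (lt0 lt1 : α → α → Prop) (ℓ : Bool) : Option α → Option α → Prop :=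
  extLT (!ℓ) (cond ℓ lt1 lt0)

/-- `[i..j] = λ_ℓ(i)`: `ŵ[i..j]` is the longest Lyndon word (w.r.t. `lt`)
starting at position `i` in `ŵ = ŵ[1..n+1]`. -/
def IsLongestLyndon (lt : Option α → Option α → Prop) (what : ℕ → Option α)
    (n i j : ℕ) : Prop :=
  i ≤ j ∧ j ≤ n + 1 ∧ IsLyndon lt (substr what i j) ∧
  ∀ j', j < j' → j' ≤ n + 1 → ¬ IsLyndon lt (substr what i j')

/-- `[iℓ..jℓ]` is an L-root of the run `(i,j,p)` w.r.t. `lt`. -/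
def IsLRoot (lt : α → α → Prop) (w : ℕ → α) (i j p iℓ jℓ : ℕ) : Prop :=
  i ≤ iℓ ∧ jℓ ≤ j ∧ jℓ + 1 = iℓ + p ∧ IsLyndon lt (substr w iℓ jℓ)

/-- The set `B_r` for the run `r = (i,j,p)` of `w[1..n]`: all L-roots
(as intervals, i.e. pairs `(iλ, jλ)`) of `r` w.r.t. the unique order `≺_ℓ`
with `ŵ[j+1] ≺_ℓ ŵ[j+1-p]`, except those starting at `i`. -/
def Br (lt0 lt1 : α → α → Prop) (w : ℕ → α) (n i j p : ℕ) : Set (ℕ × ℕ) :=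
  { q | ∃ ℓ : Bool, hatOrd lt0 lt1 ℓ (hat w n (j + 1)) (hat w n (j + 1 - p)) ∧
        IsLRoot (cond ℓ lt1 lt0) w i j p q.1 q.2 ∧ q.1 ≠ i }

/-- `p` is a period of the list `s` (0-indexed form of `s[k] = s[k+p]` for `1 ≤ k ≤ |s|-p`). -/
def ListPeriod (s : List α) (p : ℕ) : Prop :=
  ∀ k, k + p < s.length → s[k]? = s[k + p]?

/-- The suffix of the infinite word `v` starting at position `x`, ordered lexicographically. -/
def suffixAt {β : Type*} (v : ℕ → β) (x : ℕ) : Lex (ℕ → β) :=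
  toLex fun h => v (x + h)

/-- `x + p` is the first position after `x` that precedes `x` in the order `R` on positions. -/
def IsRootStart (R : ℕ → ℕ → Prop) (x p : ℕ) : Prop :=
  R (x + p) x ∧ ∀ y, x < y → y < x + p → R x y

theorem suffixAt_lt_iff {β : Type*} [LinearOrder β] {v : ℕ → β} {x y : ℕ} :
    suffixAt v x < suffixAt v y ↔
      ∃ h, (∀ h' < h, v (x + h') = v (y + h')) ∧ v (x + h) < v (y + h) :=
  Iff.rfl

theorem suffixAt_succ_lt {β : Type*} [LinearOrder β] {v : ℕ → β} {x y : ℕ} (hv : v x = v y)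
    (h : suffixAt v x < suffixAt v y) : suffixAt v (x + 1) < suffixAt v (y + 1) := by
  rw [suffixAt_lt_iff] at h ⊢
  obtain ⟨h, hagree, hlt⟩ := h
  rcases h with _ | h
  · simp [hv] at hlt
  · refine ⟨h, fun h' hh' => ?_, ?_⟩
    · have := hagree (h' + 1) (by omega)
      rwa [show x + 1 + h' = x + (h' + 1) by omega, show y + 1 + h' = y + (h' + 1) by omega]
    · rwa [show x + 1 + h = x + (h + 1) by omega, show y + 1 + h = y + (h + 1) by omega]

theorem IsRootStart.not_lt {R : ℕ → ℕ → Prop} (asymm : ∀ x y, R x y → ¬ R y x) {x p q : ℕ}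
    (hp1 : 1 ≤ p) (hp : IsRootStart R x p) (hq : IsRootStart R x q) : ¬ p < q := fun h =>
  asymm _ _ hp.1 (hq.2 (x + p) (by omega) (by omega))

/-- If a primitively rooted periodicity breaks with a smaller letter, then every window of `p`
consecutive positions contains a root start for the suffix order. -/
theorem exists_isRootStart {β : Type*} [LinearOrder β] (u : ℕ → β) (L p a : ℕ) (hp : 1 ≤ p)
    (hper : ∀ t, t + p < L → u t = u (t + p))
    (hmin : ∀ q, 1 ≤ q → q < p → ¬ ∀ t, t + q < L → u t = u (t + q))
    (hlt : u L < u (L - p)) (ha : a + 2 * p ≤ L + 1) :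
    ∃ x, a ≤ x ∧ x < a + p ∧
      IsRootStart (fun x y => suffixAt u x < suffixAt u y) x p := by
  set f : ℕ → β := fun t => u (t % p) with hf
  have hfu : ∀ t, t < L → f t = u t := by
    intro t
    induction t using Nat.strong_induction_on with
    | _ t ih =>
      intro ht
      by_cases htp : t < p
      · simp [hf, Nat.mod_eq_of_lt htp]
      · have h1 := ih (t - p) (by omega) (by omega)
        have h2 := hper (t - p) (by omega)
        rw [show t - p + p = t by omega] at h2
        rw [← h2, ← h1]
        simp only [hf]
        rw [Nat.mod_eq_sub_mod (by omega)]
  have hfp : ∀ t, f (t + p) = f t := fun t => by simp [hf]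
  have hshift : ∀ x, suffixAt f (x + p) = suffixAt f x := fun x => by
    unfold suffixAt
    congr 1
    funext h
    rw [show x + p + h = x + h + p by omega, hfp]
  obtain ⟨x, hx, hxmin⟩ := Finset.exists_min_image (Finset.Ico a (a + p)) (suffixAt f)
    ⟨a, by simp; omega⟩
  rw [Finset.mem_Ico] at hx
  have hle : ∀ y, x ≤ y → y < x + p → suffixAt f x ≤ suffixAt f y := by
    intro y hy hy'
    by_cases h : y < a + p
    · exact hxmin y (by simp; omega)
    · have := hxmin (y - p) (by simp; omega)
      rwa [← hshift (y - p), show y - p + p = y by omega] at this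
  have hne : ∀ y, x < y → y < x + p → suffixAt f x ≠ suffixAt f y := by
    intro y hy hy' heq
    obtain ⟨d, rfl⟩ : ∃ d, y = x + d := ⟨y - x, by omega⟩
    have hd : ∀ h, f (x + h) = f (x + d + h) := fun h => congrFun heq h
    have hmul : ∀ m t, f (t + p * m) = f t := fun m t => by simp [hf]
    have hd' : ∀ t, f (t + d) = f t := fun t => by
      have h1 := hd (p * x - x + t)
      have hpx : x ≤ p * x := Nat.le_mul_of_pos_left _ (by omega)
      rw [show x + (p * x - x + t) = t + p * x by omega,
        show x + d + (p * x - x + t) = t + d + p * x by omega, hmul, hmul] at h1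
      exact h1.symm
    have hdm : ∀ m t, f (t + d * m) = f t := by
      intro m
      induction m with
      | zero => simp
      | succ m ih => intro t; rw [Nat.mul_succ, ← Nat.add_assoc, hd', ih]
    have hg0 : 0 < Nat.gcd d p := Nat.gcd_pos_of_pos_right _ (by omega)
    have hgd : Nat.gcd d p ≤ d := Nat.gcd_le_left _ (by omega)
    obtain ⟨m, -, hm⟩ := Nat.exists_mul_mod_eq_gcd (n := d) (k := p) (by omega)
    refine hmin (Nat.gcd d p) hg0 (by omega) fun t ht => ?_
    rw [← hfu t (by omega), ← hfu _ ht, ← hm, ← hdm m t]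
    simp [hf]
  refine ⟨x, hx.1, hx.2, ?_, ?_⟩
  · refine suffixAt_lt_iff.2 ⟨L - p - x, fun h' hh' => ?_, ?_⟩
    · rw [show x + p + h' = x + h' + p by omega]
      exact (hper _ (by omega)).symm
    · rwa [show x + p + (L - p - x) = L by omega, show x + (L - p - x) = L - p by omega]
  · intro y hy hy'
    obtain ⟨h, hagree, hh⟩ := suffixAt_lt_iff.1 (lt_of_le_of_ne (hle y hy.le hy') (hne y hy hy'))
    have hlen : y + h < x + p := by
      by_contra hcon
      refine (hle (x + (x + p - y)) (by omega) (by omega)).not_gt ?_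
      rw [← hshift x]
      refine suffixAt_lt_iff.2 ⟨h - (x + p - y), fun h' hh' => ?_, ?_⟩
      · have := hagree (x + p - y + h') (by omega)
        rwa [← Nat.add_assoc, show y + (x + p - y + h') = x + p + h' by omega] at this
      · rwa [show x + (x + p - y) + (h - (x + p - y)) = x + h by omega,
          show x + p + (h - (x + p - y)) = y + h by omega]
    refine suffixAt_lt_iff.2 ⟨h, fun h' hh' => ?_, ?_⟩
    · rw [← hfu (x + h') (by omega), ← hfu (y + h') (by omega)]
      exact hagree h' hh'
    · rwa [← hfu (x + h) (by omega), ← hfu (y + h) (by omega)]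

theorem exists_isRootStart_gt {β : Type*} [LinearOrder β] (u : ℕ → β) (L p a : ℕ) (hp : 1 ≤ p)
    (hper : ∀ t, t + p < L → u t = u (t + p))
    (hmin : ∀ q, 1 ≤ q → q < p → ¬ ∀ t, t + q < L → u t = u (t + q))
    (hlt : u (L - p) < u L) (ha : a + 2 * p ≤ L + 1) :
    ∃ x, a ≤ x ∧ x < a + p ∧
      IsRootStart (fun x y => suffixAt u y < suffixAt u x) x p := by
  have key : ∀ x y, suffixAt (β := βᵒᵈ) (fun t => OrderDual.toDual (u t)) x <
      suffixAt (β := βᵒᵈ) (fun t => OrderDual.toDual (u t)) y → suffixAt u y < suffixAt u x := by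
    rintro x y ⟨h, hagree, hh⟩
    exact ⟨h, fun h' hh' => (hagree h' hh').symm, hh⟩
  obtain ⟨x, h1, h2, h3, h4⟩ := exists_isRootStart (β := βᵒᵈ)
    (fun t => OrderDual.toDual (u t)) L p a hp hper hmin hlt ha
  exact ⟨x, h1, h2, key _ _ h3, fun y hy hy' => key _ _ (h4 y hy hy')⟩

/-- Root starts for opposite orders on positions cannot lie strictly inside two periodic factors
simultaneously. -/
theorem IsRootStart.not_swap {β : Type*} {v : ℕ → β} {R : ℕ → ℕ → Prop}
    (asymm : ∀ x y, R x y → ¬ R y x) (trans : ∀ x y z, R x y → R y z → R x z)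
    (succ : ∀ x y, v x = v y → R x y → R (x + 1) (y + 1)) {x p q : ℕ} (hx : 1 ≤ x)
    (hp1 : 1 ≤ p) (hq1 : 1 ≤ q) (hp : IsRootStart R x p) (hq : IsRootStart (fun a b => R b a) x q)
    (hvp : v (x - 1) = v (x - 1 + p)) (hvq : v (x - 1) = v (x - 1 + q)) : False := by
  obtain ⟨hp, hp'⟩ := hp
  obtain ⟨hq, hq'⟩ := hq
  rcases Nat.lt_or_ge 1 p with hp2 | hp2 <;> rcases Nat.lt_or_ge 1 q with hq2 | hq2
  · exact asymm _ _ (hp' (x + 1) (by omega) (by omega)) (hq' (x + 1) (by omega) (by omega))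
  · obtain rfl : q = 1 := by omega
    have h1 := hp' (x - 1 + p) (by omega) (by omega)
    have h2 := succ _ _ (by rw [← hvp, hvq, Nat.sub_add_cancel hx]) h1
    rw [show x - 1 + p + 1 = x + p by omega] at h2
    exact asymm _ _ (trans _ _ _ hq h2) hp
  · obtain rfl : p = 1 := by omega
    have h1 := hq' (x - 1 + q) (by omega) (by omega)
    have h2 := succ _ _ (by rw [← hvq, hvp, Nat.sub_add_cancel hx]) h1
    rw [show x - 1 + q + 1 = x + q by omega] at h2
    exact asymm _ _ (trans _ _ _ h2 hp) hq
  · obtain rfl : p = 1 := by omega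
    obtain rfl : q = 1 := by omega
    exact asymm _ _ hp hq

open Classical in
/-- Start positions, other than the first position of the run, of the roots of a run. -/
noncomputable def rootStarts {β : Type*} [LinearOrder β] (v : ℕ → β) (r : ℕ × ℕ × ℕ) :
    Finset ℕ :=
  (Finset.Icc (r.1 + 1) (r.2.1 + 1 - r.2.2)).filter fun x =>
    IsRootStart (fun x y => suffixAt v x < suffixAt v y) x r.2.2 ∨
    IsRootStart (fun x y => suffixAt v y < suffixAt v x) x r.2.2

theorem mem_rootStarts {β : Type*} [LinearOrder β] {v : ℕ → β} {r : ℕ × ℕ × ℕ} {x : ℕ} :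
    x ∈ rootStarts v r ↔ (r.1 + 1 ≤ x ∧ x ≤ r.2.1 + 1 - r.2.2) ∧
      (IsRootStart (fun x y => suffixAt v x < suffixAt v y) x r.2.2 ∨
      IsRootStart (fun x y => suffixAt v y < suffixAt v x) x r.2.2) := by
  simp [rootStarts]

theorem hat_eq_hat_iff {α : Type*} {w : ℕ → α} {n x y : ℕ} (hx : x ≤ n) (hy : y ≤ n) :
    hat w n x = hat w n y ↔ w x = w y := by
  simp [hat, hx, hy]

/-- Two runs with the same period sharing a full period coincide. -/
theorem IsRun.endpoints_le {α : Type*} {w : ℕ → α} {n i j i' j' p x : ℕ}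
    (h : IsRun w n i j p) (h' : IsRun w n i' j' p) (hx : i < x) (hx2 : x + p ≤ j + 1)
    (hx' : i' < x) (hx2' : x + p ≤ j' + 1) : i ≤ i' ∧ j' ≤ j := by
  obtain ⟨hi, hj, hp, -, -, -, hl, hr⟩ := h
  obtain ⟨hi', hj', -, -, hper', -, -, -⟩ := h'
  constructor
  · by_contra hlt
    rcases hl with hl | hl
    · omega
    · apply hl
      rw [hper' (i - 1) (by omega) (by omega)]
      congr 1
      omega
  · by_contra hlt
    rcases hr with hr | hr
    · omega
    · apply hr
      rw [hper' (j - p + 1) (by omega) (by omega)]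
      congr 1
      omega

theorem disjoint_rootStarts {α : Type*} [LinearOrder (Option α)] {w : ℕ → α} {n : ℕ}
    {r s : ℕ × ℕ × ℕ} (hr : r ∈ Runs w n) (hs : s ∈ Runs w n) (hne : r ≠ s) :
    Disjoint (rootStarts (hat w n) r) (rootStarts (hat w n) s) := by
  rw [Finset.disjoint_left]
  intro x hxr hxs
  obtain ⟨i, j, p⟩ := r
  obtain ⟨i', j', p'⟩ := s
  rw [mem_rootStarts] at hxr hxs
  change IsRun w n i j p at hr
  change IsRun w n i' j' p' at hs
  dsimp only at hxr hxs
  obtain ⟨⟨h1, h2⟩, h3⟩ := hxr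
  obtain ⟨⟨h1', h2'⟩, h3'⟩ := hxs
  have hp : 1 ≤ p := hr.2.2.1
  have hp' : 1 ≤ p' := hs.2.2.1
  have hjn : j ≤ n := hr.2.1
  have hjn' : j' ≤ n := hs.2.1
  have hv : hat w n (x - 1) = hat w n (x - 1 + p) := by
    rw [hat_eq_hat_iff (by omega) (by omega)]
    exact hr.2.2.2.2.1 _ (by omega) (by omega)
  have hv' : hat w n (x - 1) = hat w n (x - 1 + p') := by
    rw [hat_eq_hat_iff (by omega) (by omega)]
    exact hs.2.2.2.2.1 _ (by omega) (by omega)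
  have hpp : p ≠ p' := by
    rintro rfl
    have e1 := hr.endpoints_le hs h1 (by omega) h1' (by omega)
    have e2 := hs.endpoints_le hr h1' (by omega) h1 (by omega)
    exact hne (by rw [show i = i' by omega, show j = j' by omega])
  have hsame : ∀ R : ℕ → ℕ → Prop, (∀ x y, R x y → ¬ R y x) →
      IsRootStart R x p → ¬ IsRootStart R x p' := fun R hR ha hb =>
    (Nat.lt_or_gt_of_ne hpp).elim (ha.not_lt hR hp hb) (hb.not_lt hR hp' ha)
  have hopp : ∀ {q q'}, 1 ≤ q → 1 ≤ q' → hat w n (x - 1) = hat w n (x - 1 + q) →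
      hat w n (x - 1) = hat w n (x - 1 + q') →
      IsRootStart (fun x y => suffixAt (hat w n) x < suffixAt (hat w n) y) x q →
      ¬ IsRootStart (fun x y => suffixAt (hat w n) y < suffixAt (hat w n) x) x q' :=
    fun hq hq' e e' ha hb => IsRootStart.not_swap (v := hat w n)
      (R := fun x y => suffixAt (hat w n) x < suffixAt (hat w n) y) (fun _ _ => lt_asymm)
      (fun _ _ _ => lt_trans) (fun _ _ => suffixAt_succ_lt) (by omega) hq hq' ha hb e e'
  rcases h3 with h3 | h3 <;> rcases h3' with h3' | h3'
  · exact hsame _ (fun _ _ => lt_asymm) h3 h3'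
  · exact hopp hp hp' hv hv' h3 h3'
  · exact hopp hp' hp hv' hv h3' h3
  · exact hsame _ (fun _ _ => lt_asymm) h3 h3'

theorem suffixAt_add_left {β : Type*} (v : ℕ → β) (i x : ℕ) :
    suffixAt (fun t => v (i + t)) x = suffixAt v (i + x) := by
  simp [suffixAt, Nat.add_assoc]

theorem IsRun.exists_mem_rootStarts {α : Type*} [LinearOrder (Option α)] {w : ℕ → α}
    {n i j p a : ℕ} (h : IsRun w n i j p) (ha1 : 1 ≤ a) (ha : i + a + 2 * p ≤ j + 2) :
    ∃ x, a ≤ x ∧ x < a + p ∧ i + x ∈ rootStarts (hat w n) (i, j, p) := by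
  obtain ⟨hi, hj, hp, hlen, hper, hmin, -, hr⟩ := h
  set u : ℕ → Option α := fun t => hat w n (i + t) with hu
  have hper' : ∀ t, t + p < j + 1 - i → u t = u (t + p) := fun t ht => by
    simp only [hu]
    rw [hat_eq_hat_iff (by omega) (by omega), ← Nat.add_assoc]
    exact hper _ (by omega) (by omega)
  have hmin' : ∀ q, 1 ≤ q → q < p → ¬ ∀ t, t + q < j + 1 - i → u t = u (t + q) := by
    intro q hq hqp hcon
    refine hmin q hq hqp fun t ht ht' => ?_
    have := hcon (t - i) (by omega)
    simp only [hu] at this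
    rwa [hat_eq_hat_iff (by omega) (by omega), show i + (t - i) = t by omega,
      show i + (t - i + q) = t + q by omega] at this
  have hbreak : u (j + 1 - i) ≠ u (j + 1 - i - p) := by
    simp only [hu]
    rw [show i + (j + 1 - i) = j + 1 by omega, show i + (j + 1 - i - p) = j - p + 1 by omega]
    rcases hr with rfl | hr
    · simp [hat, show j - p + 1 ≤ j by omega]
    · by_cases hjn : j + 1 ≤ n
      · rwa [Ne, hat_eq_hat_iff hjn (by omega)]
      · simp [hat, hjn, show j - p + 1 ≤ n by omega]
  rcases lt_or_gt_of_ne hbreak with hlt | hlt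
  · obtain ⟨x, hx, hx', h1, h2⟩ :=
      exists_isRootStart u (j + 1 - i) p a hp hper' hmin' hlt (by omega)
    simp only [hu, suffixAt_add_left] at h1 h2
    refine ⟨x, hx, hx', mem_rootStarts.2 ⟨⟨by simp; omega, by simp; omega⟩, Or.inl ⟨?_, ?_⟩⟩⟩
    · rwa [← Nat.add_assoc] at h1
    · intro y hy hy'
      have := h2 (y - i) (by omega) (by simp at hy'; omega)
      rwa [show i + (y - i) = y by omega] at this
  · obtain ⟨x, hx, hx', h1, h2⟩ :=
      exists_isRootStart_gt u (j + 1 - i) p a hp hper' hmin' hlt (by omega)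
    simp only [hu, suffixAt_add_left] at h1 h2
    refine ⟨x, hx, hx', mem_rootStarts.2 ⟨⟨by simp; omega, by simp; omega⟩, Or.inr ⟨?_, ?_⟩⟩⟩
    · rwa [← Nat.add_assoc] at h1
    · intro y hy hy'
      have := h2 (y - i) (by omega) (by simp at hy'; omega)
      rwa [show i + (y - i) = y by omega] at this

theorem IsRun.div_le_card_rootStarts {α : Type*} [LinearOrder (Option α)] {w : ℕ → α}
    {n i j p : ℕ} (h : IsRun w n i j p) :
    (j + 1 - i) / p ≤ (rootStarts (hat w n) (i, j, p)).card + 1 := by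
  have hp : 1 ≤ p := h.2.2.1
  have hlen : i + 2 * p ≤ j + 1 := h.2.2.2.1
  set m := (j + 1 - i) / p
  have hm : m * p ≤ j + 1 - i := Nat.div_mul_le_self _ _
  have hsub : Finset.range (m - 1) ⊆
      (rootStarts (hat w n) (i, j, p)).image fun x => (x - i - 1) / p := by
    intro t ht
    rw [Finset.mem_range] at ht
    have htm : (t + 2) * p ≤ m * p := Nat.mul_le_mul_right _ (by omega)
    have e2 : (t + 2) * p = t * p + 2 * p := by ring
    obtain ⟨x, hx, hx', hmem⟩ := h.exists_mem_rootStarts (a := t * p + 1) (by omega) (by omega)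
    refine Finset.mem_image.2 ⟨_, hmem, ?_⟩
    have e1 : (t + 1) * p = t * p + p := by ring
    exact Nat.div_eq_of_lt_le (by omega) (by omega)
  have := (Finset.card_le_card hsub).trans Finset.card_image_le
  rw [Finset.card_range] at this
  omega

theorem IsRun.expo_lt {w : ℕ → α} {n i j p : ℕ} (h : IsRun w n i j p) :
    expo (i, j, p) < ((j + 1 - i) / p : ℕ) + 1 := by
  obtain ⟨-, -, hp, hlen, -⟩ := h
  have hpos : (0 : ℚ) < p := by exact_mod_cast hp
  have hlt := Nat.lt_mul_div_succ (j + 1 - i) (b := p) (by omega)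
  have hlt' : ((j + 1 - i : ℕ) : ℚ) < p * (((j + 1 - i) / p : ℕ) + 1) := by exact_mod_cast hlt
  rw [Nat.cast_sub (by omega)] at hlt'
  push_cast at hlt'
  unfold expo
  rw [div_lt_iff₀ hpos]
  push_cast
  linarith

theorem IsRun.expo_le {α : Type*} [LinearOrder (Option α)] {w : ℕ → α} {n i j p k : ℕ}
    (hk : 2 ≤ k) (h : IsRun w n i j p) (he : (k : ℚ) ≤ expo (i, j, p)) :
    expo (i, j, p) ≤
      ((k : ℚ) + 1) / ((k : ℚ) - 1) * ((rootStarts (hat w n) (i, j, p)).card : ℚ) := by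
  have hlt := h.expo_lt
  have hcard := h.div_le_card_rootStarts
  set m := (j + 1 - i) / p
  set c := (rootStarts (hat w n) (i, j, p)).card
  have hkm : k < m + 1 := by exact_mod_cast he.trans_lt hlt
  have hk1 : (2 : ℚ) ≤ k := by exact_mod_cast hk
  have hmc : (m : ℚ) ≤ c + 1 := by exact_mod_cast hcard
  have hkc : (k : ℚ) ≤ c + 1 := by exact_mod_cast (show k ≤ c + 1 by omega)
  rw [div_mul_eq_mul_div, le_div_iff₀ (by linarith)]
  nlinarith

theorem finite_runs {α : Type*} (w : ℕ → α) (n : ℕ) : (Runs w n).Finite := by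
  refine ((Set.finite_Iic n).prod ((Set.finite_Iic n).prod (Set.finite_Iic n))).subset ?_
  rintro ⟨i, j, p⟩ ⟨hi, hj, hp, hlen, -⟩
  dsimp only at hi hj hp hlen
  simp only [Set.mem_prod, Set.mem_Iic]
  omega

theorem sum_card_rootStarts_le {α : Type*} [LinearOrder (Option α)] {w : ℕ → α} {n : ℕ}
    {s : Finset (ℕ × ℕ × ℕ)} (hs : ∀ r ∈ s, r ∈ Runs w n) :
    ∑ r ∈ s, (rootStarts (hat w n) r).card ≤ n - 1 := by
  rw [← Finset.card_biUnion fun r hr t ht hne => disjoint_rootStarts (hs r hr) (hs t ht) hne]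
  have hsub : s.biUnion (rootStarts (hat w n)) ⊆ Finset.Icc 2 n := by
    refine Finset.biUnion_subset.2 fun r hr x hx => ?_
    obtain ⟨hi, hj, hp, -⟩ := hs r hr
    obtain ⟨⟨h1, h2⟩, -⟩ := mem_rootStarts.1 hx
    rw [Finset.mem_Icc]
    omega
  simpa using Finset.card_le_card hsub

theorem runs_stmt8 {α : Type*} (k : ℕ) (hk : 2 ≤ k) (n : ℕ) (hn : 1 ≤ n) (w : ℕ → α) :
    ∑ᶠ r ∈ {r ∈ Runs w n | (k : ℚ) ≤ expo r}, expo r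
      < (n : ℚ) * ((k : ℚ) + 1) / ((k : ℚ) - 1) := by
  classical
  let _ : LinearOrder (Option α) := linearOrderOfSTO WellOrderingRel
  have hfin : {r ∈ Runs w n | (k : ℚ) ≤ expo r}.Finite := (finite_runs w n).subset fun r hr => hr.1
  have hk1 : (2 : ℚ) ≤ k := by exact_mod_cast hk
  have hc : 0 < ((k : ℚ) + 1) / ((k : ℚ) - 1) := div_pos (by linarith) (by linarith)
  have hsum : ((∑ r ∈ hfin.toFinset, (rootStarts (hat w n) r).card : ℕ) : ℚ) < n := by
    have := sum_card_rootStarts_le (w := w) (n := n) (s := hfin.toFinset)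
      fun r hr => (hfin.mem_toFinset.1 hr).1
    exact_mod_cast (show _ < n by omega)
  rw [finsum_mem_eq_finite_toFinset_sum _ hfin]
  calc ∑ r ∈ hfin.toFinset, expo r
      ≤ ∑ r ∈ hfin.toFinset,
          ((k : ℚ) + 1) / ((k : ℚ) - 1) * ((rootStarts (hat w n) r).card : ℚ) :=
        Finset.sum_le_sum fun r hr =>
          have hr := hfin.mem_toFinset.1 hr
          IsRun.expo_le hk hr.1 hr.2
    _ = ((k : ℚ) + 1) / ((k : ℚ) - 1) *
          ((∑ r ∈ hfin.toFinset, (rootStarts (hat w n) r).card : ℕ) : ℚ) := by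
        rw [← Finset.mul_sum, Nat.cast_sum]
    _ < ((k : ℚ) + 1) / ((k : ℚ) - 1) * n := mul_lt_mul_of_pos_left hsum hc
    _ = (n : ℚ) * ((k : ℚ) + 1) / ((k : ℚ) - 1) := by ring
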